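/- Let X and Y be Hausdorff topological spaces, and K, M : X ⇉ Y correspondences such that M(x) is nonempty and M(x) ⊆ K(x) for all x ∈ X. Suppose there exists a family {U_t}_{t>0} of subsets of gra(K), each open in the subspace topology of gra(K), such that: (i) ⋃_{t>0} U_t = gra(K); (ii) the closure of U_s in gra(K) is contained in U_t whenever 0 < s < t; and (iii) gra(M) = ⋂_{t>0} U_t. Then there exists a function θ : X × Y → [0,1], continuous on gra(K), such that gra(M) = {(x,y) ∈ gra(K) : θ(x,y) = sup_{z ∈ K(x)} θ(x,z)}. -/

import Mathlib

open Set

/-- The graph of a correspondence `K : X ⇉ Y`. -/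
def corrGraph {X Y : Type*} (K : X → Set Y) : Set (X × Y) := {p | p.2 ∈ K p.1}

/-- Inverse maximum theorem without normality: if there is a family `{U t}_{t>0}` of
relatively open subsets of `gra K` with `⋃_{t>0} U t = gra K`, whose relative closures
are nested (`cl(U s) ⊆ U t` for `s < t`), and with `gra M = ⋂_{t>0} U t`, then there
exists `θ : X × Y → [0,1]`, continuous on `gra K`, realizing `M` as the argmax
correspondence of `θ` over `K`. -/
theorem inverse_maximum_urysohn_family
    {X Y : Type*} [TopologicalSpace X] [T2Space X] [TopologicalSpace Y] [T2Space Y]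
    (K M : X → Set Y)
    (hMne : ∀ x, (M x).Nonempty) (hMK : ∀ x, M x ⊆ K x)
    (U : ℝ → Set (X × Y))
    (hUsub : ∀ t : ℝ, 0 < t → U t ⊆ corrGraph K)
    (hUopen : ∀ t : ℝ, 0 < t → ∃ V : Set (X × Y), IsOpen V ∧ U t = V ∩ corrGraph K)
    (hUnion : (⋃ (t : ℝ) (_ : 0 < t), U t) = corrGraph K)
    (hUcl : ∀ s t : ℝ, 0 < s → s < t → closure (U s) ∩ corrGraph K ⊆ U t)
    (hInter : corrGraph M = ⋂ (t : ℝ) (_ : 0 < t), U t) :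
    ∃ θ : X × Y → ℝ, ContinuousOn θ (corrGraph K) ∧
      (∀ p ∈ corrGraph K, θ p ∈ Icc (0 : ℝ) 1) ∧
      corrGraph M = {p ∈ corrGraph K | θ p = sSup ((fun z => θ (p.1, z)) '' K p.1)} := by
  set G := corrGraph K with hG
  let S : X × Y → Set ℝ := fun p => {t | 0 < t ∧ p ∈ U t}
  let f : X × Y → ℝ := fun p => sInf (S p)
  have hbdd : ∀ p, BddBelow (S p) := fun p => ⟨0, fun t ht => ht.1.le⟩
  have hne : ∀ p ∈ G, (S p).Nonempty := by
    intro p hp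
    rw [← hUnion] at hp
    simp only [mem_iUnion] at hp
    obtain ⟨t, ht, h⟩ := hp
    exact ⟨t, ht, h⟩
  have hf0 : ∀ p, 0 ≤ f p := fun p => Real.sInf_nonneg (fun t ht => ht.1.le)
  have hle : ∀ p t, 0 < t → p ∈ U t → f p ≤ t := fun p t ht h => csInf_le (hbdd p) ⟨ht, h⟩
  have hlt : ∀ p ∈ G, ∀ t, f p < t → p ∈ U t := by
    intro p hp t h
    obtain ⟨s, hs, hst⟩ := exists_lt_of_csInf_lt (hne p hp) h
    exact hUcl s t hs.1 hst ⟨subset_closure hs.2, hp⟩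
  have hcl : ∀ p ∈ G, ∀ s, 0 < s → p ∈ closure (U s) → f p ≤ s := by
    intro p hp s hs h
    refine le_of_forall_gt_imp_ge_of_dense fun t ht => ?_
    exact hle p t (hs.trans ht) (hUcl s t hs ht ⟨h, hp⟩)
  have hfc : ContinuousOn f G := by
    intro p hp
    rw [ContinuousWithinAt, tendsto_order]
    constructor
    · intro a ha
      by_cases ha0 : a < 0
      · exact Filter.Eventually.of_forall fun q => ha0.trans_le (hf0 q)
      · obtain ⟨s, has, hsp⟩ := exists_between ha
        have hs : 0 < s := lt_of_le_of_lt (not_lt.1 ha0) has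
        have hmem : (closure (U s))ᶜ ∈ nhds p :=
          isClosed_closure.isOpen_compl.mem_nhds fun h => absurd (hcl p hp s hs h) (not_le.2 hsp)
        filter_upwards [mem_nhdsWithin_of_mem_nhds hmem, self_mem_nhdsWithin] with q hq hqG
        refine has.trans_le (not_lt.1 fun h => hq (subset_closure (hlt q hqG s h)))
    · intro a ha
      obtain ⟨s, hps, hsa⟩ := exists_between ha
      have hs : 0 < s := (hf0 p).trans_lt hps
      obtain ⟨V, hV, hUV⟩ := hUopen s hs
      have hpV : p ∈ U s := hlt p hp s hps
      rw [hUV] at hpV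
      filter_upwards [mem_nhdsWithin_of_mem_nhds (hV.mem_nhds hpV.1), self_mem_nhdsWithin]
        with q hq hqG
      exact (hle q s hs (hUV ▸ ⟨hq, hqG⟩)).trans_lt hsa
  have hM : ∀ p ∈ G, (p ∈ corrGraph M ↔ f p = 0) := by
    intro p hp
    rw [hInter]
    simp only [mem_iInter]
    constructor
    · intro h
      refine le_antisymm ?_ (hf0 p)
      exact le_of_forall_gt_imp_ge_of_dense fun t ht => hle p t ht (h t ht)
    · intro h t ht
      exact hlt p hp t (h ▸ ht)
  have hsup : ∀ x, sSup ((fun z => max 0 (1 - f (x, z))) '' K x) = 1 := by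
    intro x
    obtain ⟨y, hy⟩ := hMne x
    refine IsGreatest.csSup_eq ⟨⟨y, hMK x hy, ?_⟩, ?_⟩
    · have : f (x, y) = 0 := (hM (x, y) (hMK x hy)).1 hy
      simp [this]
    · rintro _ ⟨z, -, rfl⟩
      have := hf0 (x, z)
      exact max_le zero_le_one (by linarith)
  refine ⟨fun p => max 0 (1 - f p), ?_, ?_, ?_⟩
  · exact ContinuousOn.sup continuousOn_const (continuousOn_const.sub hfc)
  · intro p _
    have := hf0 p
    exact ⟨le_max_left _ _, max_le zero_le_one (by linarith)⟩
  · ext p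
    simp only [mem_ofPred_eq, hsup]
    constructor
    · intro h
      have hp : p ∈ G := hMK p.1 h
      refine ⟨hp, ?_⟩
      simp [(hM p hp).1 h]
    · rintro ⟨hp, h⟩
      refine (hM p hp).2 ?_
      rcases max_choice 0 (1 - f p) with h' | h' <;> rw [h'] at h <;> linarith
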